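/- For each n, let (Ω_n, 𝒜_n, P_n) be a probability space, fix θ ∈ ℝ^k, and let Δ_n : ℝ^k × Ω_n → ℝ^k be such that Δ_n(ϑ, ·) is measurable for each ϑ. Let ϒ be an invertible k×k matrix. Assume: (i) (asymptotic linearity) for every bounded deterministic sequence (τ_n) in ℝ^k, Δ_n(θ + n^{−1/2} τ_n) − Δ_n(θ) + ϒ τ_n → 0 in P_n-probability; (ii) (Δ_n(θ)) is uniformly tight; (iii) θ̂_n : Ω_n → ℝ^k is such that (n^{1/2}(θ̂_n − θ)) is uniformly tight and asymptotically discrete, i.e., for every c > 0 there is an integer K such that, for every n, n^{1/2}(θ̂_n − θ) takes at most K distinct values in the closed ball of radius c; (iv) ϒ̂_n : Ω_n → ℝ^{k×k} are invertible random matrices with ϒ̂_n → ϒ in P_n-probability. Define the one-step estimator θ̃_n := θ̂_n + n^{−1/2} ϒ̂_n^{−1} Δ_n(θ̂_n). Then n^{1/2}(θ̃_n − θ) − ϒ^{−1} Δ_n(θ) → 0 in P_n-probability as n → ∞. -/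

import Mathlib

open MeasureTheory
open scoped BigOperators ENNReal

attribute [local instance] Matrix.normedAddCommGroup

/-- Action of a `k×k` matrix on a vector of `ℝ^k` (Euclidean space). -/
noncomputable def matVec {k : ℕ} (A : Matrix (Fin k) (Fin k) ℝ)
    (v : EuclideanSpace ℝ (Fin k)) : EuclideanSpace ℝ (Fin k) :=
  (EuclideanSpace.equiv (Fin k) ℝ).symm (A.mulVec (EuclideanSpace.equiv (Fin k) ℝ v))

theorem matVec_eq_toEuclideanCLM {k : ℕ} (A : Matrix (Fin k) (Fin k) ℝ)
    (v : EuclideanSpace ℝ (Fin k)) :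
    matVec A v = Matrix.toEuclideanCLM (n := Fin k) (𝕜 := ℝ) A v := rfl

theorem continuousAt_toEuclideanCLM_inv {k : ℕ} {A : Matrix (Fin k) (Fin k) ℝ} (hA : IsUnit A) :
    ContinuousAt (fun B : Matrix (Fin k) (Fin k) ℝ =>
      Matrix.toEuclideanCLM (n := Fin k) (𝕜 := ℝ) B⁻¹) A := by
  have hinv : ContinuousAt (fun B : Matrix (Fin k) (Fin k) ℝ => B⁻¹) A := by
    refine continuousAt_matrix_inv A ?_
    have hdet : A.det ≠ 0 := ((Matrix.isUnit_iff_isUnit_det A).mp hA).ne_zero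
    simpa [Ring.inverse_eq_inv'] using continuousAt_inv₀ hdet
  have hlin : Continuous (Matrix.toEuclideanCLM (n := Fin k) (𝕜 := ℝ)) :=
    (Matrix.toEuclideanCLM (n := Fin k) (𝕜 := ℝ)).toAlgEquiv.toLinearMap
      |>.continuous_of_finiteDimensional
  exact hlin.continuousAt.comp hinv

theorem eventually_forall_norm_le_of_tendsto {E : Type*} [NormedAddCommGroup E]
    {f : ℕ → E → ℝ≥0∞}
    (hf : ∀ τ : ℕ → E, (∃ M : ℝ, ∀ n, ‖τ n‖ ≤ M) →
      Filter.Tendsto (fun n => f n (τ n)) Filter.atTop (nhds 0))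
    (M : ℝ) {δ : ℝ≥0∞} (hδ : 0 < δ) :
    ∀ᶠ n in Filter.atTop, ∀ t, ‖t‖ ≤ M → f n t ≤ δ := by
  classical
  let τ : ℕ → E := fun n => if h : ∃ t, ‖t‖ ≤ M ∧ δ < f n t then h.choose else 0
  have hτ : ∀ n, ‖τ n‖ ≤ max M 0 := by
    intro n
    by_cases h : ∃ t, ‖t‖ ≤ M ∧ δ < f n t
    · simp only [τ, dif_pos h]
      exact h.choose_spec.1.trans (le_max_left _ _)
    · simp [τ, dif_neg h]
  filter_upwards [ENNReal.tendsto_nhds_zero.mp (hf τ ⟨_, hτ⟩) δ hδ] with n hn t ht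
  by_contra! hlt
  have h : ∃ t, ‖t‖ ≤ M ∧ δ < f n t := ⟨t, ht, hlt⟩
  simp only [τ, dif_pos h] at hn
  exact hn.not_gt h.choose_spec.2

theorem tendsto_zero_of_eventually_le_ofReal {f : ℕ → ℝ≥0∞}
    (hf : ∀ d > (0 : ℝ), ∀ᶠ n in Filter.atTop, f n ≤ ENNReal.ofReal d) :
    Filter.Tendsto f Filter.atTop (nhds 0) := by
  refine ENNReal.tendsto_nhds_zero.mpr fun δ hδ => ?_
  obtain ⟨d, hd, hdδ⟩ := ENNReal.lt_iff_exists_nnreal_btwn.mp hδ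
  filter_upwards [hf d (by exact_mod_cast hd)] with n hn
  exact hn.trans (by simpa using hdδ.le)

/-- Discretization: convergence to zero in probability along bounded deterministic sequences
extends to tight, asymptotically discrete random sequences. -/
theorem tendsto_measure_lt_norm_of_discrete {Ω : ℕ → Type*} [∀ n, MeasurableSpace (Ω n)]
    {P : ∀ n, Measure (Ω n)} {E F : Type*} [NormedAddCommGroup E] [NormedAddCommGroup F]
    {Z : ∀ n, E → Ω n → F} {T : ∀ n, Ω n → E}
    (hZ : ∀ τ : ℕ → E, (∃ M : ℝ, ∀ n, ‖τ n‖ ≤ M) → ∀ ε > (0 : ℝ),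
      Filter.Tendsto (fun n => P n {ω | ε < ‖Z n (τ n) ω‖}) Filter.atTop (nhds 0))
    (htight : ∀ ε > (0 : ℝ), ∃ M : ℝ, ∀ n, P n {ω | M < ‖T n ω‖} ≤ ENNReal.ofReal ε)
    (hdiscrete : ∀ c > (0 : ℝ), ∃ K : ℕ, ∀ n : ℕ, ∃ s : Finset E, s.card ≤ K ∧
      ∀ ω : Ω n, ‖T n ω‖ ≤ c → T n ω ∈ s)
    {ε : ℝ} (hε : 0 < ε) :
    Filter.Tendsto (fun n => P n {ω | ε < ‖Z n (T n ω) ω‖}) Filter.atTop (nhds 0) := by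
  classical
  refine tendsto_zero_of_eventually_le_ofReal fun d hd => ?_
  obtain ⟨M, hM⟩ := htight (d / 2) (by positivity)
  obtain ⟨K, hK⟩ := hdiscrete (max M 1) (by positivity)
  have hδ : 0 < d / (2 * (K + 1)) := by positivity
  filter_upwards [eventually_forall_norm_le_of_tendsto
    (f := fun n t => P n {ω | ε < ‖Z n t ω‖}) (fun τ hτ => hZ τ hτ ε hε) (max M 1)
    (ENNReal.ofReal_pos.mpr hδ)] with n hn
  obtain ⟨s, hsK, hs⟩ := hK n
  let s' := s.filter fun t => ‖t‖ ≤ max M 1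
  have hsub : {ω | ε < ‖Z n (T n ω) ω‖} ⊆
      {ω | M < ‖T n ω‖} ∪ ⋃ t ∈ s', {ω | ε < ‖Z n t ω‖} := by
    intro ω hω
    rcases lt_or_ge M ‖T n ω‖ with h | h
    · exact Or.inl h
    · have h' : ‖T n ω‖ ≤ max M 1 := h.trans (le_max_left _ _)
      refine Or.inr (Set.mem_biUnion (x := T n ω) ?_ hω)
      exact Finset.mem_coe.mpr (Finset.mem_filter.mpr ⟨hs ω h', h'⟩)
  have hcard : (s'.card : ℝ) ≤ K := by
    exact_mod_cast (Finset.card_filter_le _ _).trans hsK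
  calc P n {ω | ε < ‖Z n (T n ω) ω‖}
      ≤ P n {ω | M < ‖T n ω‖} + P n (⋃ t ∈ s', {ω | ε < ‖Z n t ω‖}) :=
        (measure_mono hsub).trans (measure_union_le _ _)
    _ ≤ ENNReal.ofReal (d / 2) + s'.card • ENNReal.ofReal (d / (2 * (K + 1))) := by
        refine add_le_add (hM n) ((measure_biUnion_finset_le _ _).trans ?_)
        exact Finset.sum_le_card_nsmul _ _ _ fun t ht => hn t (Finset.mem_filter.mp ht).2
    _ = ENNReal.ofReal (d / 2 + s'.card * (d / (2 * (K + 1)))) := by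
        rw [← ENNReal.ofReal_nsmul, nsmul_eq_mul, ENNReal.ofReal_add] <;> positivity
    _ ≤ ENNReal.ofReal d := by
        refine ENNReal.ofReal_le_ofReal ?_
        have h1 : (s'.card : ℝ) * (d / (2 * (K + 1))) ≤ (K + 1) * (d / (2 * (K + 1))) := by
          gcongr
          linarith
        have h2 : ((K : ℝ) + 1) * (d / (2 * (K + 1))) = d / 2 := by field_simp
        linarith

theorem norm_one_step_error_le {E : Type*} [NormedAddCommGroup E] [NormedSpace ℝ E]
    (A B U : E →L[ℝ] E) (hBU : ∀ v, B (U v) = v) (t x y : E) :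
    ‖t + A x - B y‖ ≤
      ‖A - B‖ * (‖y‖ + ‖U‖ * ‖t‖ + ‖x - y + U t‖) + ‖B‖ * ‖x - y + U t‖ := by
  have hx : ‖x‖ ≤ ‖y‖ + ‖U‖ * ‖t‖ + ‖x - y + U t‖ := by
    calc ‖x‖ = ‖y - U t + (x - y + U t)‖ := by congr 1; abel
      _ ≤ ‖y‖ + ‖U t‖ + ‖x - y + U t‖ :=
        (norm_add_le _ _).trans (by gcongr; exact norm_sub_le _ _)
      _ ≤ _ := by gcongr; exact U.le_opNorm t
  calc ‖t + A x - B y‖ = ‖(A - B) x + B (x - y + U t)‖ := by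
        congr 1
        simp only [sub_apply, map_add, map_sub, hBU]
        abel
    _ ≤ ‖(A - B) x‖ + ‖B (x - y + U t)‖ := norm_add_le _ _
    _ ≤ ‖A - B‖ * ‖x‖ + ‖B‖ * ‖x - y + U t‖ :=
        add_le_add ((A - B).le_opNorm _) (B.le_opNorm _)
    _ ≤ _ := by gcongr

/-- **Le Cam's one-step construction.**  Given asymptotic linearity of `Δ_n` at `θ`
(with invertible slope matrix `ϒ`), uniform tightness of `Δ_n(θ)`, a root-`n` consistent
and asymptotically discrete preliminary estimator `θ̂_n`, and consistent invertible
estimators `ϒ̂_n` of `ϒ`, the one-step estimator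
`θ̃_n := θ̂_n + n^{-1/2} ϒ̂_n⁻¹ Δ_n(θ̂_n)` satisfies
`n^{1/2}(θ̃_n − θ) − ϒ⁻¹ Δ_n(θ) → 0` in `P_n`-probability. -/
theorem le_cam_one_step
    {k : ℕ}
    (Ω : ℕ → Type*) [∀ n, MeasurableSpace (Ω n)]
    (P : ∀ n, Measure (Ω n)) [∀ n, IsProbabilityMeasure (P n)]
    (θ : EuclideanSpace ℝ (Fin k))
    (Δ : ∀ n : ℕ, EuclideanSpace ℝ (Fin k) → Ω n → EuclideanSpace ℝ (Fin k))
    (hΔmeas : ∀ n ϑ, Measurable (Δ n ϑ))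
    (Υ : Matrix (Fin k) (Fin k) ℝ) (hΥ : IsUnit Υ)
    (hlin : ∀ τ : ℕ → EuclideanSpace ℝ (Fin k), (∃ M : ℝ, ∀ n, ‖τ n‖ ≤ M) →
      ∀ ε > (0:ℝ),
        Filter.Tendsto (fun n => P n {ω |
          ε < ‖Δ n (θ + (Real.sqrt n)⁻¹ • τ n) ω - Δ n θ ω + matVec Υ (τ n)‖})
          Filter.atTop (nhds 0))
    (htight : ∀ ε > (0:ℝ), ∃ M : ℝ, ∀ n,
      P n {ω | M < ‖Δ n θ ω‖} ≤ ENNReal.ofReal ε)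
    (θhat : ∀ n : ℕ, Ω n → EuclideanSpace ℝ (Fin k))
    (hθhatmeas : ∀ n, Measurable (θhat n))
    (hθhattight : ∀ ε > (0:ℝ), ∃ M : ℝ, ∀ n,
      P n {ω | M < ‖(Real.sqrt n : ℝ) • (θhat n ω - θ)‖} ≤ ENNReal.ofReal ε)
    (hdiscrete : ∀ c > (0:ℝ), ∃ K : ℕ, ∀ n : ℕ,
      ∃ s : Finset (EuclideanSpace ℝ (Fin k)), s.card ≤ K ∧
        ∀ ω : Ω n, ‖(Real.sqrt n : ℝ) • (θhat n ω - θ)‖ ≤ c →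
          (Real.sqrt n : ℝ) • (θhat n ω - θ) ∈ s)
    (Υhat : ∀ n : ℕ, Ω n → Matrix (Fin k) (Fin k) ℝ)
    (hΥhatunit : ∀ n ω, IsUnit (Υhat n ω))
    (hΥhatcons : ∀ ε > (0:ℝ),
      Filter.Tendsto (fun n => P n {ω | ε < ‖Υhat n ω - Υ‖}) Filter.atTop (nhds 0))
    (θtilde : ∀ n : ℕ, Ω n → EuclideanSpace ℝ (Fin k))
    (hθtilde : ∀ n ω, θtilde n ω =
      θhat n ω + (Real.sqrt n)⁻¹ • matVec (Υhat n ω)⁻¹ (Δ n (θhat n ω) ω)) :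
    ∀ ε > (0:ℝ),
      Filter.Tendsto (fun n => P n {ω |
        ε < ‖(Real.sqrt n : ℝ) • (θtilde n ω - θ) - matVec Υ⁻¹ (Δ n θ ω)‖})
        Filter.atTop (nhds 0) := by
  intro ε hε
  let L := Matrix.toEuclideanCLM (n := Fin k) (𝕜 := ℝ)
  let T : ∀ n, Ω n → EuclideanSpace ℝ (Fin k) := fun n ω => (Real.sqrt n : ℝ) • (θhat n ω - θ)
  have hLinv : ∀ v, L Υ⁻¹ (L Υ v) = v := by
    intro v
    rw [← mul_apply_eq_comp, ← map_mul,
      Matrix.nonsing_inv_mul _ ((Matrix.isUnit_iff_isUnit_det Υ).mp hΥ), map_one]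
    rfl
  have hrem : ∀ r > (0 : ℝ), Filter.Tendsto (fun n => P n {ω |
      r < ‖Δ n (θ + (Real.sqrt n)⁻¹ • T n ω) ω - Δ n θ ω + matVec Υ (T n ω)‖})
      Filter.atTop (nhds 0) := fun r hr =>
    tendsto_measure_lt_norm_of_discrete
      (Z := fun n t ω => Δ n (θ + (Real.sqrt n)⁻¹ • t) ω - Δ n θ ω + matVec Υ t)
      hlin hθhattight hdiscrete hr
  refine tendsto_zero_of_eventually_le_ofReal fun d hd => ?_
  have hd4 : 0 < d / 4 := by positivity
  obtain ⟨M₁, hM₁⟩ := htight (d / 4) hd4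
  obtain ⟨M₂, hM₂⟩ := hθhattight (d / 4) hd4
  let r : ℝ := ε / (2 * (‖L Υ⁻¹‖ + 1))
  have hr : 0 < r := by positivity
  let N : ℝ := |M₁| + ‖L Υ‖ * |M₂| + r
  have hN : 0 < N := by positivity
  obtain ⟨ρ, hρ, hcont⟩ := Metric.continuousAt_iff.mp (continuousAt_toEuclideanCLM_inv hΥ)
    (ε / (2 * N)) (by positivity)
  filter_upwards [ENNReal.tendsto_nhds_zero.mp (hrem r hr) _ (ENNReal.ofReal_pos.mpr hd4),
    ENNReal.tendsto_nhds_zero.mp (hΥhatcons (ρ / 2) (by positivity)) _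
      (ENNReal.ofReal_pos.mpr hd4), Filter.eventually_gt_atTop 0] with n hR hU hn
  have hsqrt : Real.sqrt n ≠ 0 := (Real.sqrt_pos.mpr (by exact_mod_cast hn)).ne'
  have hsub : {ω | ε < ‖(Real.sqrt n : ℝ) • (θtilde n ω - θ) - matVec Υ⁻¹ (Δ n θ ω)‖} ⊆
      (({ω | M₁ < ‖Δ n θ ω‖} ∪ {ω | M₂ < ‖T n ω‖}) ∪
        {ω | r < ‖Δ n (θ + (Real.sqrt n)⁻¹ • T n ω) ω - Δ n θ ω + matVec Υ (T n ω)‖}) ∪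
        {ω | ρ / 2 < ‖Υhat n ω - Υ‖} := by
    intro ω hω
    by_contra hnot
    simp only [Set.mem_union, Set.mem_ofPred_eq, not_or, not_lt] at hnot hω
    obtain ⟨⟨⟨h1, h2⟩, h3⟩, h4⟩ := hnot
    have hθ : θ + (Real.sqrt n)⁻¹ • T n ω = θhat n ω := by
      simp only [T, smul_smul, inv_mul_cancel₀ hsqrt, one_smul, add_sub_cancel]
    have herr : (Real.sqrt n : ℝ) • (θtilde n ω - θ) - matVec Υ⁻¹ (Δ n θ ω) =
        T n ω + L (Υhat n ω)⁻¹ (Δ n (θhat n ω) ω) - L Υ⁻¹ (Δ n θ ω) := by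
      rw [hθtilde, matVec_eq_toEuclideanCLM, matVec_eq_toEuclideanCLM, add_sub_right_comm,
        smul_add, smul_smul, mul_inv_cancel₀ hsqrt, one_smul]
    rw [hθ, matVec_eq_toEuclideanCLM] at h3
    have hinv : ‖L (Υhat n ω)⁻¹ - L Υ⁻¹‖ ≤ ε / (2 * N) := by
      have := hcont (x := Υhat n ω) (by rw [dist_eq_norm]; linarith)
      rw [dist_eq_norm] at this
      exact this.le
    have hbound : ‖Δ n θ ω‖ + ‖L Υ‖ * ‖T n ω‖ +
        ‖Δ n (θhat n ω) ω - Δ n θ ω + L Υ (T n ω)‖ ≤ N := by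
      have h1' := h1.trans (le_abs_self M₁)
      have h2' := h2.trans (le_abs_self M₂)
      simp only [N]
      gcongr
    have hfirst : ε / (2 * N) * N = ε / 2 := by field_simp
    have hsecond : ‖L Υ⁻¹‖ * r ≤ ε / 2 := by
      have : (‖L Υ⁻¹‖ + 1) * r = ε / 2 := by simp only [r]; field_simp
      linarith
    refine hω.not_ge ?_
    rw [herr]
    calc _ ≤ _ := norm_one_step_error_le _ _ (L Υ) hLinv _ _ _
      _ ≤ ε / (2 * N) * N + ‖L Υ⁻¹‖ * r := by gcongr
      _ ≤ ε := by linarith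
  calc _ ≤ _ := measure_mono hsub
    _ ≤ ENNReal.ofReal (d / 4) + ENNReal.ofReal (d / 4) + ENNReal.ofReal (d / 4) +
        ENNReal.ofReal (d / 4) :=
      (measure_union_le _ _).trans (add_le_add ((measure_union_le _ _).trans
        (add_le_add ((measure_union_le _ _).trans (add_le_add (hM₁ n) (hM₂ n))) hR)) hU)
    _ = ENNReal.ofReal d := by
      rw [← ENNReal.ofReal_add, ← ENNReal.ofReal_add, ← ENNReal.ofReal_add] <;>
        first | positivity | (congr 1; ring)
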